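/- For every n ≥ 2 there exists a language L over a two-letter alphabet accepted by an n-state alternating finite automaton such that every Boolean finite automaton accepting the reversal L^R has at least 2^n states. -/

import Mathlib

/-- A Boolean finite automaton (BFA): `δ` maps each state and symbol to a
Boolean function in the state variables, `g` is the initial Boolean function,
and `accept` is the finality (characteristic) vector of the final state set. -/
structure BFA (α : Type) (σ : Type) where
  δ : σ → α → (σ → Bool) → Bool
  g : (σ → Bool) → Bool
  accept : σ → Bool

namespace BFA

variable {α σ : Type}

/-- One-symbol action on Boolean functions: `(h·a)(v) = h (fun q => δ q a v)`. -/
def stepFn (A : BFA α σ) (h : (σ → Bool) → Bool) (a : α) : (σ → Bool) → Bool :=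
  fun v => h fun q => A.δ q a v

/-- Action of a string on the initial function: `g·ε = g`, `g·(wa) = (g·w)·a`. -/
def eval (A : BFA α σ) (w : List α) : (σ → Bool) → Bool :=
  w.foldl A.stepFn A.g

/-- The language of a BFA: strings whose resulting Boolean function
evaluates to `true` on the finality vector. -/
def language (A : BFA α σ) : Language α :=
  { w | A.eval w A.accept = true }

/-- A BFA is alternating (an AFA) if its initial function is a projection. -/
def IsAFA (A : BFA α σ) : Prop :=
  ∃ q₀ : σ, A.g = fun v => v q₀

end BFA

/-- `L` is accepted by some `n`-state BFA. -/
def AcceptsBFA {α : Type} (L : Language α) (n : ℕ) : Prop :=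
  ∃ (σ : Type) (_ : Fintype σ), Fintype.card σ = n ∧ ∃ A : BFA α σ, A.language = L

/-- `L` is accepted by some `n`-state AFA. -/
def AcceptsAFA {α : Type} (L : Language α) (n : ℕ) : Prop :=
  ∃ (σ : Type) (_ : Fintype σ), Fintype.card σ = n ∧
    ∃ A : BFA α σ, A.IsAFA ∧ A.language = L

/-- `L` is accepted by some `n`-state DFA. -/
def AcceptsDFA {α : Type} (L : Language α) (n : ℕ) : Prop :=
  ∃ (σ : Type) (_ : Fintype σ), Fintype.card σ = n ∧ ∃ D : DFA α σ, D.accepts = L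

/-- `L` is accepted by some `n`-state NFA with a unique initial state. -/
def AcceptsNFA1 {α : Type} (L : Language α) (n : ℕ) : Prop :=
  ∃ (σ : Type) (_ : Fintype σ), Fintype.card σ = n ∧
    ∃ (M : NFA α σ) (q₀ : σ), M.start = {q₀} ∧ M.accepts = L

/-- The reversal of a language. -/
def Language.rev {α : Type} (L : Language α) : Language α :=
  { w | w.reverse ∈ L }

namespace BFA

variable {α σ τ : Type}

/-- The backward action of a word on valuations, the word being read from right to left. -/
def back (A : BFA α σ) (w : List α) (v : σ → Bool) : σ → Bool :=
  w.foldr (fun a u q => A.δ q a u) v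

theorem foldl_stepFn (A : BFA α σ) (w : List α) (h : (σ → Bool) → Bool) (v : σ → Bool) :
    w.foldl A.stepFn h v = h (A.back w v) := by
  induction w generalizing h with
  | nil => rfl
  | cons a w ih => rw [List.foldl_cons, ih]; rfl

theorem eval_append (A : BFA α σ) (x y : List α) (v : σ → Bool) :
    A.eval (x ++ y) v = A.eval x (A.back y v) := by
  rw [eval, List.foldl_append, foldl_stepFn, eval]

/-- If every Boolean function and every valuation is reachable in `A`, then every BFA for the
reversal of `A.language` has at least `2 ^ |σ|` states. -/
theorem two_pow_card_le_of_language_eq_rev [Fintype σ] [Fintype τ] (A : BFA α σ) (B : BFA α τ)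
    (hB : B.language = A.language.rev) (hf : ∀ f, ∃ w, A.eval w = f)
    (hv : ∀ v, ∃ w, A.back w A.accept = v) : 2 ^ Fintype.card σ ≤ Fintype.card τ := by
  classical
  choose word hword using hf
  have key : Function.Injective fun f => B.back (word f).reverse B.accept := by
    intro f f' hff
    funext v
    obtain ⟨x, rfl⟩ := hv v
    have hmem (f : (σ → Bool) → Bool) : f (A.back x A.accept) = true ↔
        B.eval x.reverse (B.back (word f).reverse B.accept) = true := by
      rw [← eval_append]
      change _ ↔ x.reverse ++ (word f).reverse ∈ B.language
      rw [hB]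
      change _ ↔ A.eval (x.reverse ++ (word f).reverse).reverse A.accept = true
      rw [List.reverse_append, List.reverse_reverse, List.reverse_reverse, eval_append, hword]
    rw [Bool.eq_iff_iff, hmem f, hmem f']
    simp only at hff
    rw [hff]
  have hcard := Fintype.card_le_of_injective _ key
  simp only [Fintype.card_fun, Fintype.card_bool] at hcard
  exact (Nat.pow_le_pow_iff_right one_lt_two).1 hcard

end BFA

/-- A family of colourings of the cycle `ZMod M` that contains an alternating colouring and is
closed under rotation and under copying the colour of `0` to `1` contains every colouring. -/
theorem forall_of_alternating_of_rotate_of_copy {M : ℕ} [NeZero M] {R : (ZMod M → Bool) → Prop}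
    {c : ZMod M → Bool} (hc : R c) (halt : ∀ x, c (x + 1) = !c x)
    (hrot : ∀ f, R f → R fun x => f (x + 1))
    (hcopy : ∀ f, R f → R fun x => f (if x = 1 then 0 else x)) (f : ZMod M → Bool) : R f := by
  have rotate (k : ℕ) (f) (hf : R f) : R fun x => f (x + k) := by
    induction k with
    | zero => simpa using hf
    | succ k ih =>
      convert hrot _ ih using 3
      push_cast
      ring
  have rotate' (y : ZMod M) (f) (hf : R f) : R fun x => f (x + y) := by
    simpa using rotate y.val f hf
  have copy (y : ZMod M) (f) (hf : R f) : R fun x => f (if x = y + 1 then y else x) := by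
    convert rotate' (-y) _ (hcopy _ (rotate' y f hf)) using 3 with x
    by_cases h : x = y + 1
    · simp [h]
    · rw [if_neg h, if_neg fun h' => h (by rw [← h']; ring)]
      ring
  have alternating (j : ℕ) (hj : j < M) : ∀ f : ZMod M → Bool,
      (∀ i < j, f ((i : ZMod M) + 1) = !f i) → R f := by
    induction Nat.le_sub_one_of_lt hj using Nat.decreasingInduction with
    | self =>
      intro f hf
      by_cases h0 : f 0 = c 0
      · have h (i : ℕ) (hi : i < M) : f i = c i := by
          induction i with
          | zero => simpa using h0
          | succ i ih =>
            rw [Nat.cast_succ, hf i (by omega), halt, ih (by omega)]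
        convert hc using 1
        funext x
        simpa using h x.val x.val_lt
      · have h (i : ℕ) (hi : i < M) : f i = c (i + 1) := by
          induction i with
          | zero =>
            rw [halt]
            simpa [Bool.eq_not_iff] using h0
          | succ i ih =>
            rw [Nat.cast_succ, hf i (by omega), halt, ih (by omega)]
        convert hrot c hc using 1
        funext x
        simpa using h x.val x.val_lt
    | of_succ j hjM ih =>
      replace ih := ih (by omega)
      intro f hf
      by_cases hj' : f ((j : ZMod M) + 1) = !f j
      · refine ih f fun i hi => ?_
        rcases Nat.lt_succ_iff_lt_or_eq.1 hi with h | rfl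
        exacts [hf i h, hj']
      · have hne (i : ℕ) (hi : i ≤ j) : (i : ZMod M) ≠ (j : ZMod M) + 1 := by
          rw [← Nat.cast_succ, Ne, ZMod.natCast_eq_natCast_iff', Nat.mod_eq_of_lt (by omega),
            Nat.mod_eq_of_lt (by omega)]
          omega
        have hcopied := copy j _ (ih (Function.update f (j + 1) (!f j)) fun i hi => ?_)
        · convert hcopied using 2 with x
          by_cases h : x = j + 1
          · rw [if_pos h, Function.update_of_ne (hne j le_rfl), h]
            simpa using hj'
          · rw [if_neg h, Function.update_of_ne h]
        · rw [Function.update_of_ne (hne i (by omega))]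
          rcases Nat.lt_succ_iff_lt_or_eq.1 hi with h | rfl
          · rw [Function.update_of_ne (by exact_mod_cast hne (i + 1) h), hf i h]
          · rw [Function.update_self]
  exact alternating 0 (NeZero.pos M) f (by simp)

theorem ZMod.finEquiv_eq_natCast (m : ℕ) [NeZero m] (y : Fin m) :
    ZMod.finEquiv m y = ((y : ℕ) : ZMod m) := by
  cases m with
  | zero => exact y.elim0
  | succ m => exact (ZMod.natCast_zmod_val (n := m + 1) y).symm

/-- The valuations of `n` variables can be arranged in a cycle along which one of the variables
alternates. -/
theorem exists_equiv_zmod_alternating (n : ℕ) [NeZero n] :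
    ∃ e : (Fin n → Bool) ≃ ZMod (2 ^ n), ∀ x, e.symm (x + 1) 0 = !e.symm x 0 := by
  let e : (Fin n → Bool) ≃ ZMod (2 ^ n) :=
    (((Equiv.refl _).arrowCongr finTwoEquiv.symm).trans finFunctionFinEquiv).trans
      (ZMod.finEquiv (2 ^ n)).toEquiv
  have he (x : ZMod (2 ^ n)) : e.symm x 0 = finTwoEquiv (ZMod.castHom
      (dvd_pow_self 2 (NeZero.ne n)) (ZMod 2) x) := by
    obtain ⟨y, rfl⟩ := (ZMod.finEquiv (2 ^ n)).surjective x
    have hsymm : e.symm (ZMod.finEquiv (2 ^ n) y) 0 =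
        finTwoEquiv (finFunctionFinEquiv.symm y 0) := by
      simp [e]
    rw [hsymm, ZMod.finEquiv_eq_natCast, map_natCast]
    congr 1
    apply Fin.ext
    change (y : ℕ) / 2 ^ 0 % 2 = ZMod.val (y : ZMod 2)
    rw [pow_zero, Nat.div_one, ZMod.val_natCast]
  refine ⟨e, fun x => ?_⟩
  rw [he, he, map_add, map_one]
  generalize ZMod.castHom _ (ZMod 2) x = y
  revert y
  decide

/-- The AFA whose valuations form a cycle via `e`, with the symbol `0` rotating the cycle and every
other symbol merging the point `1` into the point `0`. -/
def cycleAFA {n : ℕ} [NeZero n] (e : (Fin n → Bool) ≃ ZMod (2 ^ n)) : BFA (Fin 2) (Fin n) where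
  δ q a v := e.symm (if a = 0 then e v + 1 else if e v = 1 then 0 else e v) q
  g v := v 0
  accept := e.symm 0

theorem exists_eval_cycleAFA_eq {n : ℕ} [NeZero n] {e : (Fin n → Bool) ≃ ZMod (2 ^ n)}
    (he : ∀ x, e.symm (x + 1) 0 = !e.symm x 0) (f : (Fin n → Bool) → Bool) :
    ∃ w, (cycleAFA e).eval w = f := by
  have step (h : ZMod (2 ^ n) → Bool) (a : Fin 2) (H : ∃ w, (cycleAFA e).eval w = h ∘ e) :
      ∃ w, (cycleAFA e).eval w =
        (fun x => h (if a = 0 then x + 1 else if x = 1 then 0 else x)) ∘ e := by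
    obtain ⟨w, hw⟩ := H
    refine ⟨w ++ [a], ?_⟩
    funext v
    rw [BFA.eval_append, hw]
    exact congrArg h (e.apply_symm_apply _)
  have key := forall_of_alternating_of_rotate_of_copy
    (R := fun h => ∃ w, (cycleAFA e).eval w = h ∘ e) (c := fun x => e.symm x 0)
    ⟨[], by funext v; simp [BFA.eval, cycleAFA]⟩ he
    (fun h H => by simpa using step h 0 H) (fun h H => by simpa using step h 1 H) (f ∘ e.symm)
  simpa [Function.comp_assoc] using key

theorem exists_back_cycleAFA_eq {n : ℕ} [NeZero n] (e : (Fin n → Bool) ≃ ZMod (2 ^ n))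
    (v : Fin n → Bool) : ∃ w, (cycleAFA e).back w (cycleAFA e).accept = v := by
  have key (k : ℕ) : (cycleAFA e).back (List.replicate k 0) (e.symm 0) = e.symm k := by
    induction k with
    | zero => simp [BFA.back]
    | succ k ih =>
      change (fun q => (cycleAFA e).δ q 0 ((cycleAFA e).back (List.replicate k 0) (e.symm 0))) = _
      rw [ih]
      funext q
      simp [cycleAFA]
  exact ⟨List.replicate (e v).val 0, (key _).trans (by simp)⟩

/-- Reversal lower bound: for every `n ≥ 2` there is a binary language accepted
by an `n`-state AFA such that every BFA for `L^R` has at least `2^n` states. -/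
theorem reversal_lower (n : ℕ) (hn : 2 ≤ n) :
    ∃ L : Language (Fin 2), AcceptsAFA L n ∧
      ∀ k : ℕ, AcceptsBFA L.rev k → 2 ^ n ≤ k := by
  have : NeZero n := ⟨by omega⟩
  obtain ⟨e, he⟩ := exists_equiv_zmod_alternating n
  refine ⟨(cycleAFA e).language,
    ⟨Fin n, inferInstance, Fintype.card_fin n, cycleAFA e, ⟨0, rfl⟩, rfl⟩, ?_⟩
  rintro k ⟨τ, _, rfl, B, hB⟩
  simpa using (cycleAFA e).two_pow_card_le_of_language_eq_rev B hB
    (exists_eval_cycleAFA_eq he) (exists_back_cycleAFA_eq e)
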